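/- For every feasible single-source capacitated cost-sharing game on a series of k parallel-edge blocks with boundary sinks and n agents, every strong equilibrium σ, and every feasible profile τ, the social cost of σ is at most H_n times the social cost of τ, where H_n = 1 + 1/2 + … + 1/n. -/

import Mathlib

/-- The load of edge `e` of block `j`: the number of agents whose path reaches
block `j` (i.e. `j < m i`, with blocks indexed from `0`) and who chose `e` there. -/
def ssLoad {n k : ℕ} {E : Fin k → Type*} [∀ j, Fintype (E j)] [∀ j, DecidableEq (E j)]
    (m : Fin n → ℕ) (σ : Fin n → ∀ j, E j) (j : Fin k) (e : E j) : ℕ :=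
  (Finset.univ.filter fun i => (j : ℕ) < m i ∧ σ i j = e).card

/-- A profile is feasible if no edge load exceeds its capacity. -/
def FeasibleS {n k : ℕ} {E : Fin k → Type*} [∀ j, Fintype (E j)] [∀ j, DecidableEq (E j)]
    (m : Fin n → ℕ) (c : ∀ j, E j → ℕ) (σ : Fin n → ∀ j, E j) : Prop :=
  ∀ j e, ssLoad m σ j e ≤ c j e

/-- The cost of agent `i`: over the blocks her path traverses, the cost of her chosen
edge divided equally among its users. -/
noncomputable def agentCostS {n k : ℕ} {E : Fin k → Type*}
    [∀ j, Fintype (E j)] [∀ j, DecidableEq (E j)]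
    (m : Fin n → ℕ) (p : ∀ j, E j → ℝ) (σ : Fin n → ∀ j, E j) (i : Fin n) : ℝ :=
  ∑ j : Fin k, if (j : ℕ) < m i then p j (σ i j) / (ssLoad m σ j (σ i j) : ℝ) else 0

/-- The social cost of a profile: the sum of all agents' costs. -/
noncomputable def socialCostS {n k : ℕ} {E : Fin k → Type*}
    [∀ j, Fintype (E j)] [∀ j, DecidableEq (E j)]
    (m : Fin n → ℕ) (p : ∀ j, E j → ℝ) (σ : Fin n → ∀ j, E j) : ℝ :=
  ∑ i, agentCostS m p σ i

/-- A feasible profile is a strong equilibrium if no nonempty coalition has a feasible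
deviation, agreeing with the original profile outside the coalition (on all blocks its
members actually traverse), that strictly decreases the cost of each of its members. -/
def IsStrongEqS {n k : ℕ} {E : Fin k → Type*} [∀ j, Fintype (E j)] [∀ j, DecidableEq (E j)]
    (m : Fin n → ℕ) (p : ∀ j, E j → ℝ) (c : ∀ j, E j → ℕ) (σ : Fin n → ∀ j, E j) : Prop :=
  FeasibleS m c σ ∧
    ¬ ∃ (C : Finset (Fin n)) (σ' : Fin n → ∀ j, E j),
        C.Nonempty ∧ FeasibleS m c σ' ∧
        (∀ i ∉ C, ∀ j : Fin k, (j : ℕ) < m i → σ' i j = σ i j) ∧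
        ∀ i ∈ C, agentCostS m p σ' i < agentCostS m p σ i

/-- The `m`-th harmonic number `1 + 1/2 + ⋯ + 1/m` (with value `0` at `m = 0`). -/
noncomputable def harmonicReal (m : ℕ) : ℝ :=
  ∑ i ∈ Finset.range m, (1 : ℝ) / (i + 1)

/-- Among the assignments with the same fibre sizes over `S` as `g`, some `g'` is such that each of
its fibres over `S` is comparable by inclusion with the corresponding fibre of `f`. -/
theorem exists_rearrangement_fibres_comparable {ι α : Type*} [Fintype ι] [DecidableEq ι]
    [Fintype α] [DecidableEq α] (S : Finset ι) (f g : ι → α) :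
    ∃ g' : ι → α, (∀ e, (S.filter fun i => g' i = e).card = (S.filter fun i => g i = e).card) ∧
      ∀ e, (∀ i ∈ S, f i = e → g' i = e) ∨ (∀ i ∈ S, g' i = e → f i = e) := by
  classical
  let G : Finset (ι → α) := Finset.univ.filter fun g' =>
    ∀ e, (S.filter fun i => g' i = e).card = (S.filter fun i => g i = e).card
  obtain ⟨g', hg', hmax⟩ := G.exists_max_image
    (fun g' => (S.filter fun i => g' i = f i).card) ⟨g, by simp [G]⟩
  have hload := (Finset.mem_filter.1 hg').2
  refine ⟨g', hload, fun e => ?_⟩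
  by_contra! h
  obtain ⟨⟨a, ha, hfa, hga⟩, b, hb, hgb, hfb⟩ := h
  have hswap : ∀ i, Equiv.swap a b i ∈ S ↔ i ∈ S := by
    intro i
    rcases eq_or_ne i a with rfl | hia
    · simp [ha, hb]
    rcases eq_or_ne i b with rfl | hib
    · simp [ha, hb]
    rw [Equiv.swap_apply_of_ne_of_ne hia hib]
  have hmem : (fun i => g' (Equiv.swap a b i)) ∈ G := by
    refine Finset.mem_filter.2 ⟨Finset.mem_univ _, fun e' => ?_⟩
    rw [← hload e']
    exact Finset.card_equiv (Equiv.swap a b) (by simp [hswap])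
  refine absurd (hmax _ hmem) (not_le.2 (Finset.card_lt_card ?_))
  rw [Finset.ssubset_iff_of_subset]
  · exact ⟨a, by simp [ha, hgb, hfa], by simp [hfa, hga]⟩
  · intro i hi
    obtain ⟨hiS, hi⟩ := Finset.mem_filter.1 hi
    refine Finset.mem_filter.2 ⟨hiS, ?_⟩
    have hia : i ≠ a := by rintro rfl; exact hga (hi.trans hfa)
    have hib : i ≠ b := by rintro rfl; exact hfb (hi.symm.trans hgb)
    simpa [Equiv.swap_apply_of_ne_of_ne hia hib] using hi

theorem harmonicReal_succ (l : ℕ) : harmonicReal (l + 1) = harmonicReal l + 1 / (l + 1) :=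
  Finset.sum_range_succ _ _

theorem harmonicReal_mono : Monotone harmonicReal :=
  monotone_nat_of_le_succ fun l => by
    rw [harmonicReal_succ]
    exact le_add_of_nonneg_right (by positivity)

section CostSharing

variable {n k : ℕ} {E : Fin k → Type*} [∀ j, DecidableEq (E j)]

/-- The number of members of `C` who reach block `j` and choose `e` there. -/
def coalitionLoad (m : Fin n → ℕ) (C : Finset (Fin n)) (τ : Fin n → ∀ j, E j)
    (j : Fin k) (e : E j) : ℕ :=
  (C.filter fun i => (j : ℕ) < m i ∧ τ i j = e).card

theorem coalitionLoad_erase_of_mem {m : Fin n → ℕ} {C : Finset (Fin n)} {i : Fin n} (hi : i ∈ C)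
    (τ : Fin n → ∀ j, E j) {j : Fin k} (hj : (j : ℕ) < m i) :
    coalitionLoad m C τ j (τ i j) = coalitionLoad m (C.erase i) τ j (τ i j) + 1 := by
  unfold coalitionLoad
  rw [Finset.filter_erase, Finset.card_erase_add_one]
  exact Finset.mem_filter.2 ⟨hi, hj, rfl⟩

theorem coalitionLoad_erase_of_not {m : Fin n → ℕ} {C : Finset (Fin n)} {i : Fin n}
    {τ : Fin n → ∀ j, E j} {j : Fin k} {e : E j} (h : ¬((j : ℕ) < m i ∧ τ i j = e)) :
    coalitionLoad m (C.erase i) τ j e = coalitionLoad m C τ j e := by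
  unfold coalitionLoad
  rw [Finset.filter_erase, Finset.erase_eq_of_notMem]
  exact fun hmem => h (Finset.mem_filter.1 hmem).2

variable [∀ j, Fintype (E j)]

theorem coalitionLoad_univ (m : Fin n → ℕ) (τ : Fin n → ∀ j, E j) (j : Fin k) (e : E j) :
    coalitionLoad m Finset.univ τ j e = ssLoad m τ j e := rfl

/-- Rosenthal's potential of the members of `C` playing `τ` on their own. -/
noncomputable def coalitionPotential (m : Fin n → ℕ) (p : ∀ j, E j → ℝ)
    (C : Finset (Fin n)) (τ : Fin n → ∀ j, E j) : ℝ :=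
  ∑ j, ∑ e, p j e * harmonicReal (coalitionLoad m C τ j e)

theorem coalitionPotential_erase (m : Fin n → ℕ) (p : ∀ j, E j → ℝ) {C : Finset (Fin n)}
    {i : Fin n} (hi : i ∈ C) (τ : Fin n → ∀ j, E j) :
    coalitionPotential m p C τ = coalitionPotential m p (C.erase i) τ +
      ∑ j : Fin k, if (j : ℕ) < m i then
        p j (τ i j) / (coalitionLoad m C τ j (τ i j) : ℝ) else 0 := by
  unfold coalitionPotential
  rw [← Finset.sum_add_distrib]
  refine Finset.sum_congr rfl fun j _ => ?_
  split_ifs with hj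
  · rw [← Finset.add_sum_erase _ _ (Finset.mem_univ (τ i j)),
      ← Finset.add_sum_erase Finset.univ
        (fun e => p j e * harmonicReal (coalitionLoad m (C.erase i) τ j e))
        (Finset.mem_univ (τ i j)),
      Finset.sum_congr rfl fun e he => by
        rw [← coalitionLoad_erase_of_not (C := C) fun h => Finset.ne_of_mem_erase he h.2.symm],
      coalitionLoad_erase_of_mem hi τ hj, harmonicReal_succ]
    push_cast
    ring
  · rw [add_zero]
    exact Finset.sum_congr rfl fun e _ => by rw [coalitionLoad_erase_of_not fun h => hj h.1]

theorem socialCostS_eq_sum_edges (m : Fin n → ℕ) (p : ∀ j, E j → ℝ) (τ : Fin n → ∀ j, E j) :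
    socialCostS m p τ =
      ∑ j, ∑ e, (ssLoad m τ j e : ℝ) * (p j e / (ssLoad m τ j e : ℝ)) := by
  unfold socialCostS agentCostS
  rw [Finset.sum_comm]
  refine Finset.sum_congr rfl fun j _ => ?_
  rw [← Finset.sum_filter, ← Finset.sum_fiberwise _ (fun i => τ i j)]
  refine Finset.sum_congr rfl fun e _ => ?_
  rw [Finset.filter_filter, Finset.sum_congr rfl fun i hi => by
    rw [(Finset.mem_filter.1 hi).2.2], Finset.sum_const, nsmul_eq_mul]
  rfl

theorem coalitionPotential_univ_le (m : Fin n → ℕ) {p : ∀ j, E j → ℝ} (hp : ∀ j e, 0 ≤ p j e)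
    (τ : Fin n → ∀ j, E j) :
    coalitionPotential m p Finset.univ τ ≤ harmonicReal n * socialCostS m p τ := by
  rw [socialCostS_eq_sum_edges, Finset.mul_sum]
  refine Finset.sum_le_sum fun j _ => ?_
  rw [Finset.mul_sum]
  refine Finset.sum_le_sum fun e _ => ?_
  rw [coalitionLoad_univ]
  rcases Nat.eq_zero_or_pos (ssLoad m τ j e) with h | h
  · simp [h, harmonicReal]
  · have hle : ssLoad m τ j e ≤ n := by
      simpa [ssLoad] using Finset.card_filter_le (Finset.univ : Finset (Fin n))
        fun i => (j : ℕ) < m i ∧ τ i j = e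
    rw [mul_div_cancel₀ _ (by positivity), mul_comm]
    exact mul_le_mul_of_nonneg_right (harmonicReal_mono hle) (hp j e)

/-- The profile in which `C` plays `τ` and everyone else plays `σ`. -/
def hybridProfile (C : Finset (Fin n)) (τ σ : Fin n → ∀ j, E j) : Fin n → ∀ j, E j :=
  fun i => if i ∈ C then τ i else σ i

/-- If on every edge the users under one of `σ`, `τ` include the users under the other, then any
coalition may switch from `σ` to `τ` without violating capacities. -/
theorem FeasibleS.hybridProfile {m : Fin n → ℕ} {c : ∀ j, E j → ℕ} {σ τ : Fin n → ∀ j, E j}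
    (hσ : FeasibleS m c σ) (hτ : FeasibleS m c τ)
    (h : ∀ (j : Fin k) (e : E j), (∀ i, (j : ℕ) < m i → σ i j = e → τ i j = e) ∨
      (∀ i, (j : ℕ) < m i → τ i j = e → σ i j = e))
    (C : Finset (Fin n)) : FeasibleS m c (hybridProfile C τ σ) := by
  intro j e
  rcases h j e with h | h
  · refine (Finset.card_le_card fun i hi => ?_).trans (hτ j e)
    obtain ⟨hj, hi⟩ := (Finset.mem_filter.1 hi).2
    refine Finset.mem_filter.2 ⟨Finset.mem_univ i, hj, ?_⟩
    by_cases hC : i ∈ C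
    · simpa [_root_.hybridProfile, hC] using hi
    · exact h i hj (by simpa [_root_.hybridProfile, hC] using hi)
  · refine (Finset.card_le_card fun i hi => ?_).trans (hσ j e)
    obtain ⟨hj, hi⟩ := (Finset.mem_filter.1 hi).2
    refine Finset.mem_filter.2 ⟨Finset.mem_univ i, hj, ?_⟩
    by_cases hC : i ∈ C
    · exact h i hj (by simpa [_root_.hybridProfile, hC] using hi)
    · simpa [_root_.hybridProfile, hC] using hi

theorem agentCostS_hybridProfile_le (m : Fin n → ℕ) {p : ∀ j, E j → ℝ} (hp : ∀ j e, 0 ≤ p j e)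
    (σ τ : Fin n → ∀ j, E j) {C : Finset (Fin n)} {i : Fin n} (hi : i ∈ C) :
    agentCostS m p (hybridProfile C τ σ) i ≤
      ∑ j : Fin k, if (j : ℕ) < m i then
        p j (τ i j) / (coalitionLoad m C τ j (τ i j) : ℝ) else 0 := by
  refine Finset.sum_le_sum fun j _ => ?_
  split_ifs with hj
  · have hτi : hybridProfile C τ σ i = τ i := if_pos hi
    rw [hτi]
    refine div_le_div_of_nonneg_left (hp _ _) ?_ ?_
    · rw [coalitionLoad_erase_of_mem hi τ hj]
      positivity
    · refine Nat.cast_le.2 (Finset.card_le_card fun a ha => ?_)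
      obtain ⟨haC, ha⟩ := Finset.mem_filter.1 ha
      exact Finset.mem_filter.2 ⟨Finset.mem_univ a, by simpa [hybridProfile, haC] using ha⟩
  · exact le_rfl

theorem IsStrongEqS.sum_agentCostS_le_coalitionPotential {m : Fin n → ℕ} {p : ∀ j, E j → ℝ}
    (hp : ∀ j e, 0 ≤ p j e) {c : ∀ j, E j → ℕ} {σ τ : Fin n → ∀ j, E j}
    (hσ : IsStrongEqS m p c σ) (hfeas : ∀ C, FeasibleS m c (hybridProfile C τ σ))
    (C : Finset (Fin n)) :
    ∑ i ∈ C, agentCostS m p σ i ≤ coalitionPotential m p C τ := by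
  induction C using Finset.strongInduction with
  | H C ih =>
    rcases C.eq_empty_or_nonempty with rfl | hC
    · simp [coalitionPotential, coalitionLoad, harmonicReal]
    · obtain ⟨i, hi, hle⟩ : ∃ i ∈ C, agentCostS m p σ i ≤
          agentCostS m p (hybridProfile C τ σ) i := by
        by_contra! h
        exact hσ.2 ⟨C, hybridProfile C τ σ, hC, hfeas C,
          fun i hi j _ => by simp [hybridProfile, hi], h⟩
      rw [← Finset.sum_erase_add _ _ hi, coalitionPotential_erase m p hi τ]
      exact add_le_add (ih _ (Finset.erase_ssubset hi))
        (hle.trans (agentCostS_hybridProfile_le m hp σ τ hi))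

end CostSharing

/-- In every feasible single-source capacitated cost-sharing game on a series of `k`
parallel-edge blocks with boundary sinks and `n` agents, the social cost of any strong
equilibrium is at most `H_n` times the social cost of any feasible profile. -/
theorem single_source_blocks_SPoA_le_harmonic
    {n k : ℕ} (hn : 1 ≤ n) (hk : 1 ≤ k)
    {E : Fin k → Type*} [∀ j, Fintype (E j)] [∀ j, DecidableEq (E j)] [∀ j, Nonempty (E j)]
    (p : ∀ j, E j → ℝ) (hp : ∀ j e, 0 ≤ p j e) (c : ∀ j, E j → ℕ)
    (m : Fin n → ℕ) (hm : ∀ i, 1 ≤ m i ∧ m i ≤ k)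
    (σ : Fin n → ∀ j, E j) (hσ : IsStrongEqS m p c σ)
    (τ : Fin n → ∀ j, E j) (hτ : FeasibleS m c τ) :
    socialCostS m p σ ≤ harmonicReal n * socialCostS m p τ := by
  have hrearr := fun j : Fin k => exists_rearrangement_fibres_comparable
    (Finset.univ.filter fun i => (j : ℕ) < m i) (fun i => σ i j) (fun i => τ i j)
  choose g hg hcomp using hrearr
  let τ' : Fin n → ∀ j, E j := fun i j => g j i
  have hload : ∀ j e, ssLoad m τ' j e = ssLoad m τ j e := by
    intro j e
    have h := hg j e
    rw [Finset.filter_filter, Finset.filter_filter] at h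
    exact h
  have hτ' : FeasibleS m c τ' := fun j e => (hload j e).trans_le (hτ j e)
  have hfeas : ∀ C, FeasibleS m c (hybridProfile C τ' σ) :=
    hσ.1.hybridProfile hτ' fun j e => by simpa using hcomp j e
  have hcost : socialCostS m p τ' = socialCostS m p τ := by
    simp only [socialCostS_eq_sum_edges, hload]
  calc socialCostS m p σ ≤ coalitionPotential m p Finset.univ τ' :=
        hσ.sum_agentCostS_le_coalitionPotential hp hfeas Finset.univ
    _ ≤ harmonicReal n * socialCostS m p τ' := coalitionPotential_univ_le m hp τ'
    _ = harmonicReal n * socialCostS m p τ := by rw [hcost]
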